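/- Let Ω ⊂ ℝ² be a bounded domain with C¹ boundary, a₁, a₂ > 0, and suppose that at every boundary point with x₁x₂ ≠ 0 the outward unit normal ν satisfies a₁ν₁/x₁ = a₂ν₂/x₂. If ∂Ω is connected, then ∂Ω is contained in an ellipse of the form a₂x₁² + a₁x₂² = c for some constant c > 0. -/

import Mathlib

open Filter Topology MeasureTheory Set

lemma littleO_of_tangent (K : Set (Fin 2 → ℝ)) (x : Fin 2 → ℝ) (p q : ℝ)
    (h : ∀ v ∈ tangentConeAt ℝ K x, p * v 0 + q * v 1 = 0) (ε : ℝ) (hε : 0 < ε) :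
    ∃ δ > 0, ∀ y ∈ K, ‖y - x‖ < δ →
      |p * (y 0 - x 0) + q * (y 1 - x 1)| ≤ ε * ‖y - x‖ := by
  by_contra! hcon
  have hpos : ∀ n : ℕ, (0 : ℝ) < 1 / ((n : ℝ) + 1) := fun n => by positivity
  choose y hyK hyd hy using fun n : ℕ => hcon (1 / ((n : ℝ) + 1)) (hpos n)
  have hne : ∀ n, 0 < ‖y n - x‖ := by
    intro n
    rcases (norm_nonneg (y n - x)).eq_or_lt with h0 | h0
    · exfalso
      have h1 : y n - x = 0 := norm_eq_zero.mp h0.symm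
      have h2 := hy n
      have e0 : y n 0 - x 0 = 0 := congrFun h1 0
      have e1 : y n 1 - x 1 = 0 := congrFun h1 1
      rw [e0, e1, ← h0] at h2
      simp at h2
    · exact h0
  have hd0 : Tendsto (fun n => y n - x) atTop (𝓝 0) := by
    apply squeeze_zero_norm (fun n => (hyd n).le)
    exact tendsto_one_div_add_atTop_nhds_zero_nat
  let u : ℕ → (Fin 2 → ℝ) := fun n => ‖y n - x‖⁻¹ • (y n - x)
  have hu : ∀ n, u n ∈ Metric.closedBall (0 : Fin 2 → ℝ) 1 := by
    intro n
    simp only [u, mem_closedBall_zero_iff, norm_smul, norm_inv, norm_norm]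
    rw [inv_mul_cancel₀ (hne n).ne']
  obtain ⟨v, -, φ, hφ, hlim⟩ := (isCompact_closedBall (0 : Fin 2 → ℝ) 1).tendsto_subseq hu
  have hv : v ∈ tangentConeAt ℝ K x := by
    refine mem_tangentConeAt_of_seq atTop (fun n => ‖y (φ n) - x‖⁻¹) (fun n => y (φ n) - x)
      (hd0.comp hφ.tendsto_atTop) (Eventually.of_forall fun n => ?_) hlim
    simpa using hyK (φ n)
  have hv0 := h v hv
  have hcont : Continuous (fun w : Fin 2 → ℝ => |p * w 0 + q * w 1|) := by fun_prop
  have ht := (hcont.tendsto v).comp hlim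
  have hge : ε ≤ |p * v 0 + q * v 1| := by
    refine ge_of_tendsto ht (Eventually.of_forall fun n => ?_)
    have h3 := hy (φ n)
    have h4 := hne (φ n)
    have : p * u (φ n) 0 + q * u (φ n) 1
        = ‖y (φ n) - x‖⁻¹ * (p * (y (φ n) 0 - x 0) + q * (y (φ n) 1 - x 1)) := by
      simp [u]; ring
    simp only [Function.comp]
    rw [this, abs_mul, abs_inv, abs_norm, inv_mul_eq_div, le_div_iff₀ h4]
    exact h3.le
  rw [hv0, abs_zero] at hge
  linarith

lemma norm2_le (w : Fin 2 → ℝ) (c : ℝ) : ‖w‖ ≤ c ↔ |w 0| ≤ c ∧ |w 1| ≤ c := by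
  constructor
  · intro h
    exact ⟨(norm_le_pi_norm w 0).trans h, (norm_le_pi_norm w 1).trans h⟩
  · rintro ⟨h0, h1⟩
    refine (pi_norm_le_iff_of_nonneg ((abs_nonneg _).trans h0)).2 fun i => ?_
    fin_cases i
    · exact h0
    · exact h1

lemma sard_null (K : Set (Fin 2 → ℝ)) (b : Fin 2 → ℝ) (hb : ∀ k, 0 < b k)
    (h : ∀ x ∈ K, x 0 * x 1 ≠ 0 → ∀ ε > 0, ∃ δ > 0, ∀ y ∈ K, ‖y - x‖ < δ →
      |b 0 * x 0 * (y 0 - x 0) + b 1 * x 1 * (y 1 - x 1)| ≤ ε * ‖y - x‖) :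
    volume ((fun x : Fin 2 → ℝ => b 0 * x 0 ^ 2 + b 1 * x 1 ^ 2) ''
      {x | x ∈ K ∧ x 0 * x 1 ≠ 0}) = 0 := by
  set f : (Fin 2 → ℝ) → ℝ := fun x => b 0 * x 0 ^ 2 + b 1 * x 1 ^ 2 with hf
  set D : Set (Fin 2 → ℝ) := {x | x ∈ K ∧ x 0 * x 1 ≠ 0} with hD
  have hfd : ∀ x ∈ D, ∀ ε > 0, ∃ δ > 0, ∀ y ∈ K, ‖y - x‖ < δ → |f y - f x| ≤ ε * ‖y - x‖ := by
    intro x hx ε hε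
    obtain ⟨δ, hδ, hδ'⟩ := h x hx.1 hx.2 (ε / 4) (by positivity)
    have hB : 0 < b 0 + b 1 := add_pos (hb 0) (hb 1)
    refine ⟨min δ (ε / (2 * (b 0 + b 1))), lt_min hδ (by positivity), fun y hy hyx => ?_⟩
    have h1 := hδ' y hy (hyx.trans_le (min_le_left _ _))
    have h2 := (hyx.trans_le (min_le_right _ _)).le
    rw [le_div_iff₀ (by positivity)] at h2
    obtain ⟨n0, n1⟩ := (norm2_le (y - x) ‖y - x‖).1 le_rfl
    simp only [Pi.sub_apply] at n0 n1
    set r := ‖y - x‖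
    have hr : 0 ≤ r := norm_nonneg _
    have e : f y - f x = 2 * (b 0 * x 0 * (y 0 - x 0) + b 1 * x 1 * (y 1 - x 1))
        + (b 0 * (y 0 - x 0) ^ 2 + b 1 * (y 1 - x 1) ^ 2) := by simp only [hf]; ring
    have s0 : (y 0 - x 0) ^ 2 ≤ r ^ 2 := sq_le_sq' (by linarith [(abs_le.1 n0).1]) (abs_le.1 n0).2
    have s1 : (y 1 - x 1) ^ 2 ≤ r ^ 2 := sq_le_sq' (by linarith [(abs_le.1 n1).1]) (abs_le.1 n1).2
    have t0 := mul_le_mul_of_nonneg_left s0 (hb 0).le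
    have t1 := mul_le_mul_of_nonneg_left s1 (hb 1).le
    have u0 := mul_nonneg (hb 0).le (sq_nonneg (y 0 - x 0))
    have u1 := mul_nonneg (hb 1).le (sq_nonneg (y 1 - x 1))
    have w := mul_le_mul_of_nonneg_left h2 hr
    obtain ⟨l1, l2⟩ := abs_le.1 h1
    rw [e, abs_le]
    constructor <;> nlinarith
  let Dn : ℕ → Set (Fin 2 → ℝ) := fun n => {x | x ∈ D ∧ ∀ y ∈ K, ‖y - x‖ < 1 / ((n : ℝ) + 1) →
    |y 1 - x 1| ≤ ((n : ℝ) + 1) * |y 0 - x 0|}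
  have hcover : ∀ x ∈ D, ∃ n, x ∈ Dn n := by
    intro x hx
    have hx0 : x 0 ≠ 0 := left_ne_zero_of_mul hx.2
    have hx1 : x 1 ≠ 0 := right_ne_zero_of_mul hx.2
    set c := |b 1 * x 1| / 2 with hc
    have hcpos : 0 < c := by
      have := abs_pos.2 (mul_ne_zero (hb 1).ne' hx1)
      positivity
    obtain ⟨δ, hδ, hδ'⟩ := h x hx.1 hx.2 c hcpos
    obtain ⟨n, hn⟩ := exists_nat_gt (max (1 / δ) ((|b 0 * x 0| + c) / c))
    have hn1 : 1 / δ < n := (le_max_left _ _).trans_lt hn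
    have hn2 : (|b 0 * x 0| + c) / c < n := (le_max_right _ _).trans_lt hn
    refine ⟨n, hx, fun y hy hyx => ?_⟩
    have hyδ : ‖y - x‖ < δ := by
      refine hyx.trans ?_
      rw [div_lt_iff₀ hδ] at hn1
      rw [div_lt_iff₀ (by positivity)]
      nlinarith
    have h1 := hδ' y hy hyδ
    have hnorm : ‖y - x‖ ≤ |y 0 - x 0| + |y 1 - x 1| := by
      rw [norm2_le]
      simp only [Pi.sub_apply]
      constructor <;> linarith [abs_nonneg (y 0 - x 0), abs_nonneg (y 1 - x 1)]
    have h2 : |b 1 * x 1 * (y 1 - x 1)| ≤ |b 0 * x 0 * (y 0 - x 0)|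
        + |b 0 * x 0 * (y 0 - x 0) + b 1 * x 1 * (y 1 - x 1)| := by
      have := abs_sub (b 0 * x 0 * (y 0 - x 0) + b 1 * x 1 * (y 1 - x 1)) (b 0 * x 0 * (y 0 - x 0))
      rw [add_sub_cancel_left] at this
      linarith
    rw [abs_mul (b 1 * x 1), abs_mul (b 0 * x 0)] at h2
    have h3 : |b 1 * x 1| = 2 * c := by rw [hc]; ring
    rw [h3] at h2
    have h4 : c * |y 1 - x 1| ≤ (|b 0 * x 0| + c) * |y 0 - x 0| := by
      nlinarith [mul_le_mul_of_nonneg_left hnorm hcpos.le]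
    rw [div_lt_iff₀ hcpos] at hn2
    have h5 : (|b 0 * x 0| + c) * |y 0 - x 0| ≤ c * (((n : ℝ) + 1) * |y 0 - x 0|) := by
      nlinarith [mul_le_mul_of_nonneg_right hn2.le (abs_nonneg (y 0 - x 0)),
        mul_nonneg hcpos.le (abs_nonneg (y 0 - x 0))]
    exact le_of_mul_le_mul_left (h4.trans h5) hcpos
  let z := TopologicalSpace.denseSeq (Fin 2 → ℝ)
  let E : ℕ → ℕ → Set (Fin 2 → ℝ) := fun n k => Dn n ∩ Metric.ball (z k) (1 / (2 * ((n : ℝ) + 1)))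
  have hsub : f '' D ⊆ ⋃ n, ⋃ k, f '' E n k := by
    rintro _ ⟨x, hx, rfl⟩
    obtain ⟨n, hn⟩ := hcover x hx
    obtain ⟨k, hk⟩ := (TopologicalSpace.denseRange_denseSeq (Fin 2 → ℝ)).exists_dist_lt x
      (show (0 : ℝ) < 1 / (2 * ((n : ℝ) + 1)) by positivity)
    exact mem_iUnion.2 ⟨n, mem_iUnion.2 ⟨k, x, ⟨hn, hk⟩, rfl⟩⟩
  refine measure_mono_null hsub ?_
  rw [measure_iUnion_null_iff]; intro n
  rw [measure_iUnion_null_iff]; intro k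
  -- on `E n k` the first coordinate is injective with Lipschitz inverse
  have hN : (0 : ℝ) < (n : ℝ) + 1 := by positivity
  have hlip : ∀ x ∈ E n k, ∀ y ∈ E n k, ‖y - x‖ ≤ ((n : ℝ) + 1) * |y 0 - x 0| := by
    intro x hx y hy
    have hd : ‖y - x‖ < 1 / ((n : ℝ) + 1) := by
      have h1 := Metric.mem_ball.1 hx.2
      have h2 := Metric.mem_ball.1 hy.2
      have h3 := dist_triangle_right y x (z k)
      rw [← dist_eq_norm]
      have : 1 / ((n : ℝ) + 1) = 1 / (2 * ((n : ℝ) + 1)) + 1 / (2 * ((n : ℝ) + 1)) := by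
        field_simp; norm_num
      linarith
    have h4 := hx.1.2 y hy.1.1.1 hd
    rw [norm2_le]
    simp only [Pi.sub_apply]
    refine ⟨?_, h4⟩
    have : (0 : ℝ) ≤ n := by positivity
    nlinarith [abs_nonneg (y 0 - x 0)]
  let pr : (Fin 2 → ℝ) → ℝ := fun x => x 0
  have hinj : InjOn pr (E n k) := by
    intro x hx y hy hxy
    have := hlip x hx y hy
    have e : y 0 - x 0 = 0 := sub_eq_zero.2 hxy.symm
    rw [e, abs_zero, mul_zero] at this
    exact (sub_eq_zero.1 (norm_le_zero_iff.1 this)).symm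
  let inv := Function.invFunOn pr (E n k)
  have hinv : ∀ x ∈ E n k, inv (pr x) = x := fun x hx => hinj.leftInvOn_invFunOn hx
  have himg : f '' E n k = (f ∘ inv) '' (pr '' E n k) := by
    rw [image_image]
    exact image_congr fun x hx => by simp [hinv x hx]
  rw [himg]
  refine addHaar_image_eq_zero_of_det_fderivWithin_eq_zero volume (f' := fun _ => 0) ?_ ?_
  · rintro _ ⟨x, hx, rfl⟩
    rw [hasFDerivWithinAt_iff_isLittleO]
    rw [Asymptotics.isLittleO_iff]
    intro c hc
    obtain ⟨δ, hδ, hδ'⟩ := hfd x hx.1.1 (c / ((n : ℝ) + 1)) (by positivity)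
    rw [eventually_nhdsWithin_iff]
    filter_upwards [Metric.ball_mem_nhds (pr x) (show 0 < δ / ((n : ℝ) + 1) by positivity)]
    rintro _ hd ⟨y, hy, rfl⟩
    have hd1 : |y 0 - x 0| < δ / ((n : ℝ) + 1) := hd
    rw [lt_div_iff₀ hN] at hd1
    have h1 := hlip x hx y hy
    have h2 := hδ' y hy.1.1.1 (by nlinarith)
    simp only [Function.comp, hinv x hx, hinv y hy, zero_apply, sub_zero,
      Real.norm_eq_abs]
    refine h2.trans ?_
    have h3 := mul_le_mul_of_nonneg_left h1 (show 0 ≤ c / ((n : ℝ) + 1) by positivity)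
    refine h3.trans (le_of_eq ?_)
    simp only [pr]
    field_simp
  · intro x _
    simp

/-- The quadratic form. -/
def qf (b : Fin 2 → ℝ) (x : Fin 2 → ℝ) : ℝ := b 0 * x 0 ^ 2 + b 1 * x 1 ^ 2

/-- The point with `i`-th coordinate `s` and other coordinate `t`. -/
def pt (i : Fin 2) (s t : ℝ) : Fin 2 → ℝ := fun k => if k = i then s else t

/-- The open quadrant of signs `σ`. -/
def Quad (σ : Fin 2 → ℝ) (x : Fin 2 → ℝ) : Prop := ∀ k, 0 < σ k * x k

lemma pt_i (i : Fin 2) (s t : ℝ) : pt i s t i = s := by simp [pt]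

lemma pt_j {i j : Fin 2} (hij : i ≠ j) (s t : ℝ) : pt i s t j = t := by simp [pt, hij.symm]

lemma sum_ij {i j : Fin 2} (hij : i ≠ j) (g : Fin 2 → ℝ) : g 0 + g 1 = g i + g j := by
  fin_cases i <;> fin_cases j <;> simp_all [add_comm]

lemma forall_ij {i j : Fin 2} (hij : i ≠ j) {p : Fin 2 → Prop} : (∀ k, p k) ↔ p i ∧ p j := by
  fin_cases i <;> fin_cases j <;> simp_all [Fin.forall_fin_two, and_comm]

lemma qf_ij {i j : Fin 2} (hij : i ≠ j) (b x : Fin 2 → ℝ) :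
    qf b x = b i * x i ^ 2 + b j * x j ^ 2 := sum_ij hij (fun k => b k * x k ^ 2)

lemma qf_pt {i j : Fin 2} (hij : i ≠ j) (b : Fin 2 → ℝ) (s t : ℝ) :
    qf b (pt i s t) = b i * s ^ 2 + b j * t ^ 2 := by
  rw [qf_ij hij, pt_i, pt_j hij]

lemma normij_le {i j : Fin 2} (hij : i ≠ j) (w : Fin 2 → ℝ) (c : ℝ) :
    ‖w‖ ≤ c ↔ |w i| ≤ c ∧ |w j| ≤ c := by
  rw [norm2_le, ← forall_ij hij (p := fun k => |w k| ≤ c), Fin.forall_fin_two]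

lemma continuous_pt (i : Fin 2) {g h : ℝ → ℝ} (hg : Continuous g) (hh : Continuous h) :
    Continuous fun s => pt i (g s) (h s) := by
  refine continuous_pi fun k => ?_
  by_cases hk : k = i
  · simpa [pt, hk] using hg
  · simpa [pt, hk] using hh

lemma continuous_qf (b : Fin 2 → ℝ) : Continuous (qf b) := by
  unfold qf; fun_prop

lemma qf_smul (b x : Fin 2 → ℝ) (r : ℝ) : qf b (r • x) = r ^ 2 * qf b x := by
  simp [qf]; ring

lemma sgn_sq {σ : ℝ} (h : σ = 1 ∨ σ = -1) : σ ^ 2 = 1 := by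
  rcases h with rfl | rfl <;> norm_num

lemma quad_pos {b σ x : Fin 2 → ℝ} (hb : ∀ k, 0 < b k) (hx : Quad σ x) : 0 < qf b x := by
  have h0 : x 0 ≠ 0 := fun h => by have := hx 0; simp [h] at this
  have := hb 0
  have := hb 1
  unfold qf
  positivity

lemma mem_of_preconnected {Ω A : Set (Fin 2 → ℝ)} (hA : IsPreconnected A)
    (hd : ∀ x ∈ A, x ∉ frontier Ω) {x : Fin 2 → ℝ} (hx : x ∈ A) (hxΩ : x ∈ Ω)
    {y : Fin 2 → ℝ} (hy : y ∈ A) : y ∈ Ω := by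
  by_contra hyΩ
  have := isPreconnected_iff_subset_of_disjoint.1 hA (interior Ω) (closure Ω)ᶜ isOpen_interior
    isClosed_closure.isOpen_compl (fun w hw => by
      by_contra hcon
      simp only [mem_union, mem_compl_iff, not_or, not_not] at hcon
      exact hd w hw ⟨hcon.2, hcon.1⟩) (by
      ext w
      simp only [mem_inter_iff, mem_compl_iff, mem_empty_iff_false, iff_false]
      rintro ⟨-, h1, h2⟩
      exact h2 (subset_closure (interior_subset h1)))
  rcases this with h | h
  · exact hyΩ (interior_subset (h hy))
  · exact h hx (subset_closure hxΩ)

lemma arc_subset {Ω : Set (Fin 2 → ℝ)} {b σ : Fin 2 → ℝ} (hb : ∀ k, 0 < b k)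
    (hσ : ∀ k, σ k = 1 ∨ σ k = -1) {N : Set ℝ}
    (hN : ∀ x ∈ frontier Ω, x 0 * x 1 ≠ 0 → qf b x ∈ N) {t : ℝ} (htN : t ∉ N)
    {x : Fin 2 → ℝ} (hx : x ∈ Ω) (hxQ : Quad σ x) (hxt : qf b x = t)
    {y : Fin 2 → ℝ} (hyQ : Quad σ y) (hyt : qf b y = t) : y ∈ Ω := by
  have ht : 0 < t := hxt ▸ quad_pos hb hxQ
  let γ : ℝ → Fin 2 → ℝ := fun r =>
    pt 0 (σ 0 * √(r * t / b 0)) (σ 1 * √((1 - r) * t / b 1))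
  have hγ : Continuous γ := continuous_pt 0 (by fun_prop) (by fun_prop)
  have key : ∀ w, Quad σ w → qf b w = t → w ∈ γ '' Ioo 0 1 := by
    intro w hw hwt
    have h01 : (0 : Fin 2) ≠ 1 := by decide
    have hw0 : w 0 ≠ 0 := fun h => by have := hw 0; simp [h] at this
    have hw1 : w 1 ≠ 0 := fun h => by have := hw 1; simp [h] at this
    have hb0 := hb 0
    have hb1 := hb 1
    have p0 : 0 < b 0 * w 0 ^ 2 := by positivity
    have p1 : 0 < b 1 * w 1 ^ 2 := by positivity
    have hsum : b 0 * w 0 ^ 2 + b 1 * w 1 ^ 2 = t := hwt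
    refine ⟨b 0 * w 0 ^ 2 / t, ⟨by positivity, ?_⟩, ?_⟩
    · rw [div_lt_one ht]; linarith
    · have e0 : b 0 * w 0 ^ 2 / t * t / b 0 = (σ 0 * w 0) ^ 2 := by
        rw [mul_pow, sgn_sq (hσ 0)]; field_simp
      have e1 : (1 - b 0 * w 0 ^ 2 / t) * t / b 1 = (σ 1 * w 1) ^ 2 := by
        rw [mul_pow, sgn_sq (hσ 1)]; field_simp; linarith
      funext k
      fin_cases k
      · show pt 0 _ _ 0 = _
        rw [pt_i, e0, Real.sqrt_sq (hw 0).le, ← mul_assoc, ← sq, sgn_sq (hσ 0), one_mul]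
        rfl
      · show pt 0 _ _ 1 = _
        rw [pt_j h01, e1, Real.sqrt_sq (hw 1).le, ← mul_assoc, ← sq, sgn_sq (hσ 1), one_mul]
        rfl
  refine mem_of_preconnected (isPreconnected_Ioo.image γ hγ.continuousOn) ?_
    (key x hxQ hxt) hx (key y hyQ hyt)
  rintro _ ⟨r, hr, rfl⟩ hfr
  have h01 : (0 : Fin 2) ≠ 1 := by decide
  have hb0 := hb 0
  have hb1 := hb 1
  have hr0 : 0 < r := hr.1
  have hr1 : 0 < 1 - r := by linarith [hr.2]
  have s0 : 0 < √(r * t / b 0) := Real.sqrt_pos.2 (by positivity)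
  have s1 : 0 < √((1 - r) * t / b 1) := Real.sqrt_pos.2 (by positivity)
  have n0 : σ 0 ≠ 0 := by rcases hσ 0 with h | h <;> rw [h] <;> norm_num
  have n1 : σ 1 ≠ 0 := by rcases hσ 1 with h | h <;> rw [h] <;> norm_num
  have := hN _ hfr (by
    show pt 0 _ _ 0 * pt 0 _ _ 1 ≠ 0
    rw [pt_i, pt_j h01]
    exact mul_ne_zero (mul_ne_zero n0 s0.ne') (mul_ne_zero n1 s1.ne'))
  apply htN
  convert this using 1
  show t = qf b (pt 0 _ _)
  rw [qf_pt h01, mul_pow, mul_pow, sgn_sq (hσ 0), sgn_sq (hσ 1),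
    Real.sq_sqrt (by positivity), Real.sq_sqrt (by positivity)]
  field_simp
  ring

/-- `Ω` reaches the level `M` inside the quadrant `σ`. -/
def Reach (Ω : Set (Fin 2 → ℝ)) (b : Fin 2 → ℝ) (M : ℝ) (σ : Fin 2 → ℝ) : Prop :=
  ∀ ε > 0, ∃ x ∈ Ω, Quad σ x ∧ M - ε < qf b x

lemma good_level {Ω : Set (Fin 2 → ℝ)} (hΩ : IsOpen Ω) {b σ : Fin 2 → ℝ} (hb : ∀ k, 0 < b k)
    (hσ : ∀ k, σ k = 1 ∨ σ k = -1) {N : Set ℝ}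
    (hN : ∀ x ∈ frontier Ω, x 0 * x 1 ≠ 0 → qf b x ∈ N)
    (hnull : ∀ a c : ℝ, a < c → ∃ t ∈ Ioo a c, t ∉ N) {M : ℝ}
    (hM : ∀ x ∈ Ω, qf b x ≤ M) (hR : Reach Ω b M σ) (ε : ℝ) (hε : 0 < ε) :
    ∃ t, M - ε < t ∧ t < M ∧ 0 < t ∧ ∀ y, Quad σ y → qf b y = t → y ∈ Ω := by
  obtain ⟨x, hx, hxQ, hxε⟩ := hR ε hε
  have hpos := quad_pos hb hxQ
  have hcont : ContinuousAt (fun t : ℝ => √(t / qf b x) • x) (qf b x) := by fun_prop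
  have hev : ∀ᶠ t in 𝓝 (qf b x), √(t / qf b x) • x ∈ Ω := by
    apply hcont.eventually_mem
    apply hΩ.mem_nhds
    simpa [div_self hpos.ne'] using hx
  obtain ⟨δ, hδ, hball⟩ := Metric.eventually_nhds_iff.1 hev
  obtain ⟨t, ⟨ht1, ht2⟩, htN⟩ := hnull (max (max (M - ε) (qf b x - δ)) 0) (qf b x)
    (max_lt (max_lt hxε (by linarith)) hpos)
  simp only [max_lt_iff] at ht1
  obtain ⟨⟨h1, h2⟩, h3⟩ := ht1
  have hmem : √(t / qf b x) • x ∈ Ω := hball (by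
    rw [Real.dist_eq, abs_lt]; constructor <;> linarith)
  have hs : 0 < √(t / qf b x) := Real.sqrt_pos.2 (by positivity)
  refine ⟨t, h1, ht2.trans_le (hM x hx), h3, fun y hy hyt => ?_⟩
  refine arc_subset hb hσ hN htN hmem ?_ ?_ hy hyt
  · intro k
    have := mul_pos hs (hxQ k)
    simp only [Pi.smul_apply, smul_eq_mul]
    linarith
  · rw [qf_smul, Real.sq_sqrt (by positivity)]
    field_simp

lemma top_arc {Ω : Set (Fin 2 → ℝ)} (hΩ : IsOpen Ω) {b σ : Fin 2 → ℝ} (hb : ∀ k, 0 < b k)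
    (hσ : ∀ k, σ k = 1 ∨ σ k = -1) {N : Set ℝ}
    (hN : ∀ x ∈ frontier Ω, x 0 * x 1 ≠ 0 → qf b x ∈ N)
    (hnull : ∀ a c : ℝ, a < c → ∃ t ∈ Ioo a c, t ∉ N) {M : ℝ}
    (hM : ∀ x ∈ Ω, qf b x ≤ M) (hR : Reach Ω b M σ)
    {x : Fin 2 → ℝ} (hxQ : Quad σ x) (hx : qf b x = M) : x ∈ frontier Ω := by
  have hMpos : 0 < M := hx ▸ quad_pos hb hxQ
  rw [hΩ.frontier_eq]
  constructor
  · rw [Metric.mem_closure_iff]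
    intro ε hε
    have hcont : ContinuousAt (fun t : ℝ => √(t / M) • x) M := by fun_prop
    have hev : ∀ᶠ t in 𝓝 M, √(t / M) • x ∈ Metric.ball x ε := by
      apply hcont.eventually_mem
      apply Metric.isOpen_ball.mem_nhds
      simpa [div_self hMpos.ne'] using hε
    obtain ⟨δ, hδ, hball⟩ := Metric.eventually_nhds_iff.1 hev
    obtain ⟨t, h1, h2, h3, h4⟩ := good_level hΩ hb hσ hN hnull hM hR δ hδ
    have hs : 0 < √(t / M) := Real.sqrt_pos.2 (by positivity)
    refine ⟨√(t / M) • x, h4 _ ?_ ?_, ?_⟩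
    · intro k
      have := mul_pos hs (hxQ k)
      simp only [Pi.smul_apply, smul_eq_mul]
      linarith
    · rw [qf_smul, Real.sq_sqrt (by positivity), hx]
      field_simp
    · rw [dist_comm]
      exact hball (by rw [Real.dist_eq, abs_lt]; constructor <;> linarith)
  · intro hxΩ
    have hcont : ContinuousAt (fun r : ℝ => r • x) 1 := by fun_prop
    have hev : ∀ᶠ r in 𝓝 (1 : ℝ), r • x ∈ Ω :=
      hcont.eventually_mem (hΩ.mem_nhds (by simpa using hxΩ))
    obtain ⟨δ, hδ, hball⟩ := Metric.eventually_nhds_iff.1 hev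
    have := hM _ (hball (y := 1 + δ / 2) (by
      rw [Real.dist_eq, abs_lt]; constructor <;> linarith))
    rw [qf_smul, hx] at this
    nlinarith [mul_pos hδ hMpos, mul_pos (mul_pos hδ hδ) hMpos]

lemma endpoint {Ω : Set (Fin 2 → ℝ)} (hΩ : IsOpen Ω) {b σ : Fin 2 → ℝ} (hb : ∀ k, 0 < b k)
    (hσ : ∀ k, σ k = 1 ∨ σ k = -1) {N : Set ℝ}
    (hN : ∀ x ∈ frontier Ω, x 0 * x 1 ≠ 0 → qf b x ∈ N)
    (hnull : ∀ a c : ℝ, a < c → ∃ t ∈ Ioo a c, t ∉ N) {M : ℝ} (hMpos : 0 < M)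
    (hM : ∀ x ∈ Ω, qf b x ≤ M) (hR : Reach Ω b M σ)
    (hν : ∀ x ∈ frontier Ω, ∃ n : Fin 2 → ℝ, n 0 ^ 2 + n 1 ^ 2 = 1 ∧ ∀ ε > 0, ∃ δ > 0,
      ∀ y ∈ frontier Ω, ‖y - x‖ < δ →
        |n 0 * (y 0 - x 0) + n 1 * (y 1 - x 1)| ≤ ε * ‖y - x‖)
    {i j : Fin 2} (hij : i ≠ j) :
    ∃ δ > 0, ∀ y ∈ frontier Ω, |y i| < δ → |y j - σ j * √(M / b j)| < δ →
      |y j - σ j * √(M / b j)| ≤ |y i| / 2 := by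
  have hbi := hb i
  have hbj := hb j
  set q := √(M / b j) with hq
  have hqpos : 0 < q := Real.sqrt_pos.2 (by positivity)
  have hq2 : b j * q ^ 2 = M := by rw [hq, Real.sq_sqrt (by positivity)]; field_simp
  set p := pt i 0 (σ j * q) with hp
  let w : ℝ → ℝ := fun s => √((M - b i * s ^ 2) / b j)
  let γ : ℝ → Fin 2 → ℝ := fun s => pt i (σ i * s) (σ j * w s)
  have hγ : Continuous γ := continuous_pt i (by fun_prop) (by fun_prop)
  have hγ0 : γ 0 = p := by simp [γ, w, hp, hq]
  have hsmall : ∀ᶠ s in 𝓝[>] (0 : ℝ), 0 < s ∧ 0 < M - b i * s ^ 2 := by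
    have h1 : ∀ᶠ s in 𝓝 (0 : ℝ), 0 < M - b i * s ^ 2 := by
      have : ContinuousAt (fun s : ℝ => M - b i * s ^ 2) 0 := by fun_prop
      exact this.eventually_const_lt (by simpa using hMpos)
    filter_upwards [self_mem_nhdsWithin, nhdsWithin_le_nhds h1] with s hs hs' using ⟨hs, hs'⟩
  have hw2 : ∀ s, 0 < M - b i * s ^ 2 → b j * w s ^ 2 = M - b i * s ^ 2 := by
    intro s hs
    simp only [w]
    rw [Real.sq_sqrt (by positivity)]; field_simp
  have hγK : ∀ᶠ s in 𝓝[>] (0 : ℝ), γ s ∈ frontier Ω := by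
    filter_upwards [hsmall] with s ⟨hs, hs'⟩
    refine top_arc hΩ hb hσ hN hnull hM hR ?_ ?_
    · have hws : 0 < w s := Real.sqrt_pos.2 (by positivity)
      refine (forall_ij hij).2 ⟨?_, ?_⟩
      · simp only [γ, pt_i]
        rw [← mul_assoc, ← sq, sgn_sq (hσ i), one_mul]; exact hs
      · simp only [γ, pt_j hij]
        rw [← mul_assoc, ← sq, sgn_sq (hσ j), one_mul]; exact hws
    · simp only [γ]
      rw [qf_pt hij, mul_pow, mul_pow, sgn_sq (hσ i), sgn_sq (hσ j), one_mul, one_mul, hw2 s hs']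
      ring
  have htend : Tendsto γ (𝓝[>] 0) (𝓝 p) := by
    have := hγ.tendsto 0
    rw [hγ0] at this
    exact this.mono_left nhdsWithin_le_nhds
  have hpK : p ∈ frontier Ω := isClosed_frontier.mem_of_tendsto htend hγK
  obtain ⟨n, hn1, hn⟩ := hν p hpK
  have hn1' : n i ^ 2 + n j ^ 2 = 1 := by rw [← sum_ij hij (fun k => n k ^ 2)]; exact hn1
  have hpi : p i = 0 := pt_i _ _ _
  have hpj : p j = σ j * q := pt_j hij _ _
  have hn' : ∀ ε > 0, ∃ δ > 0, ∀ y ∈ frontier Ω, ‖y - p‖ < δ →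
      |n i * y i + n j * (y j - σ j * q)| ≤ ε * ‖y - p‖ := by
    intro ε hε
    obtain ⟨δ, hδ, h⟩ := hn ε hε
    refine ⟨δ, hδ, fun y hy hyd => ?_⟩
    have := h y hy hyd
    rw [sum_ij hij (fun k => n k * (y k - p k)), hpi, hpj, sub_zero] at this
    exact this
  have habs : ∀ k, |σ k| = 1 := fun k => by rcases hσ k with h | h <;> rw [h] <;> simp
  have hni : n i = 0 := by
    by_contra hne
    have hα : 0 < |n i| := abs_pos.2 hne
    obtain ⟨δ, hδ, hδ'⟩ := hn' (|n i| / 4) (by positivity)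
    set C := b i / (b j * q) with hC
    have hCpos : 0 < C := by positivity
    have hnear : ∀ᶠ s in 𝓝[>] (0 : ℝ), ‖γ s - p‖ < δ := by
      have := htend.eventually (Metric.ball_mem_nhds p hδ)
      simpa [dist_eq_norm] using this
    have hs1 : ∀ᶠ s in 𝓝[>] (0 : ℝ), C * s * (1 + |n i| / 4) < |n i| / 4 := by
      have : ContinuousAt (fun s : ℝ => C * s * (1 + |n i| / 4)) 0 := by fun_prop
      exact nhdsWithin_le_nhds (this.eventually_lt_const (by simpa using hα))
    obtain ⟨s, ⟨hs, hs'⟩, hsK, hsn, hsC⟩ := (hsmall.and (hγK.and (hnear.and hs1))).exists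
    have h1 := hδ' _ hsK hsn
    have hγi : γ s i = σ i * s := pt_i _ _ _
    have hγj : γ s j = σ j * w s := pt_j hij _ _
    have hw0 : 0 ≤ w s := Real.sqrt_nonneg _
    have hww := hw2 s hs'
    have hwq : w s ≤ q := by
      apply Real.sqrt_le_sqrt
      gcongr
      have : 0 < b i * s ^ 2 := by positivity
      linarith
    have hdiff : q - w s ≤ C * s ^ 2 := by
      rw [hC, div_mul_eq_mul_div, le_div_iff₀ (by positivity)]
      have : b j * (q - w s) * (q + w s) = b i * s ^ 2 := by
        linear_combination hq2 - hww
      have h2 : 0 ≤ b j * (q - w s) * w s :=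
        mul_nonneg (mul_nonneg hbj.le (by linarith)) hw0
      nlinarith
    have hnorm : ‖γ s - p‖ ≤ s + C * s ^ 2 := by
      have hCs : 0 ≤ C * s ^ 2 := by positivity
      rw [normij_le hij]
      simp only [Pi.sub_apply, hγi, hγj, hpi, hpj, sub_zero]
      constructor
      · rw [abs_mul, habs, one_mul, abs_of_pos hs]; linarith
      · rw [← mul_sub, abs_mul, habs, one_mul, abs_sub_comm, abs_of_nonneg (by linarith)]
        linarith
    have hnj : |n j| ≤ 1 := by
      rw [← sq_le_one_iff_abs_le_one]; nlinarith [sq_nonneg (n i)]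
    rw [hγi, hγj] at h1
    have h3 : |n i * (σ i * s)| ≤ |n i * (σ i * s) + n j * (σ j * w s - σ j * q)|
        + |n j * (σ j * w s - σ j * q)| := by
      have := abs_sub (n i * (σ i * s) + n j * (σ j * w s - σ j * q))
        (n j * (σ j * w s - σ j * q))
      rwa [add_sub_cancel_right] at this
    have h4 : |n i * (σ i * s)| = |n i| * s := by
      rw [abs_mul, abs_mul, habs, one_mul, abs_of_pos hs]
    have h5 : |n j * (σ j * w s - σ j * q)| ≤ C * s ^ 2 := by
      rw [← mul_sub, abs_mul, abs_mul, habs, one_mul, abs_sub_comm,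
        abs_of_nonneg (show 0 ≤ q - w s by linarith)]
      nlinarith [abs_nonneg (n j)]
    have h6 : |n i| * s ≤ |n i| / 4 * (s + C * s ^ 2) + C * s ^ 2 := by
      have := mul_le_mul_of_nonneg_left hnorm (show 0 ≤ |n i| / 4 by positivity)
      linarith
    have h7 := mul_lt_mul_of_pos_right hsC hs
    nlinarith [mul_pos hα hs]
  have hnj : |n j| = 1 := by
    rw [hni] at hn1'
    have : n j ^ 2 = 1 := by linarith
    rw [← abs_one, ← sq_eq_sq_iff_abs_eq_abs, this, one_pow]
  obtain ⟨δ, hδ, hδ'⟩ := hn' (1 / 2) (by norm_num)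
  refine ⟨δ / 2, by positivity, fun y hy h1 h2 => ?_⟩
  have hyn : ‖y - p‖ ≤ max |y i| |y j - σ j * q| := by
    rw [normij_le hij]
    simp only [Pi.sub_apply, hpi, hpj, sub_zero]
    exact ⟨le_max_left _ _, le_max_right _ _⟩
  have h3 := hδ' y hy (hyn.trans_lt (max_lt (by linarith) (by linarith)))
  rw [hni, zero_mul, zero_add, abs_mul, hnj, one_mul] at h3
  rcases max_cases |y i| |y j - σ j * q| with ⟨h, h'⟩ | ⟨h, h'⟩ <;> rw [h] at hyn
  · linarith
  · linarith [abs_nonneg (y i)]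

lemma flip_reach {Ω : Set (Fin 2 → ℝ)} (hΩ : IsOpen Ω) {b σ : Fin 2 → ℝ} (hb : ∀ k, 0 < b k)
    (hσ : ∀ k, σ k = 1 ∨ σ k = -1) {N : Set ℝ}
    (hN : ∀ x ∈ frontier Ω, x 0 * x 1 ≠ 0 → qf b x ∈ N)
    (hnull : ∀ a c : ℝ, a < c → ∃ t ∈ Ioo a c, t ∉ N) {M : ℝ} (hMpos : 0 < M)
    (hM : ∀ x ∈ Ω, qf b x ≤ M) (hR : Reach Ω b M σ)
    (hν : ∀ x ∈ frontier Ω, ∃ n : Fin 2 → ℝ, n 0 ^ 2 + n 1 ^ 2 = 1 ∧ ∀ ε > 0, ∃ δ > 0,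
      ∀ y ∈ frontier Ω, ‖y - x‖ < δ →
        |n 0 * (y 0 - x 0) + n 1 * (y 1 - x 1)| ≤ ε * ‖y - x‖)
    {i j : Fin 2} (hij : i ≠ j) {τ : Fin 2 → ℝ} (hτi : τ i = -σ i) (hτj : τ j = σ j) :
    Reach Ω b M τ := by
  obtain ⟨δ, hδ, hδK⟩ := endpoint hΩ hb hσ hN hnull hMpos hM hR hν hij
  have hbi := hb i
  have hbj := hb j
  set q := √(M / b j) with hq
  have hqpos : 0 < q := Real.sqrt_pos.2 (by positivity)
  have hq2 : b j * q ^ 2 = M := by rw [hq, Real.sq_sqrt (by positivity)]; field_simp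
  have habs : ∀ k, |σ k| = 1 := fun k => by rcases hσ k with h | h <;> rw [h] <;> simp
  have hσσ : ∀ k r, σ k * (σ k * r) = r := fun k r => by
    rw [← mul_assoc, ← sq, sgn_sq (hσ k), one_mul]
  let H : ℝ → ℝ → ℝ → Set (Fin 2 → ℝ) := fun α β r => {w | α * w i + β * w j < r}
  have hH : ∀ α β r, Convex ℝ (H α β r) := fun α β r =>
    convex_halfSpace_lt (f := fun w : Fin 2 → ℝ => α * w i + β * w j)
      ⟨fun x y => by simp; ring, fun c x => by simp; ring⟩ r
  let R : Set (Fin 2 → ℝ) := H 1 0 δ ∩ H (-1) 0 δ ∩ (H 0 1 (δ + σ j * q) ∩ H 0 (-1) (δ - σ j * q))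
    ∩ (H 1 (σ j) q ∩ H (-1) (σ j) q)
  have hRconv : Convex ℝ R :=
    (((hH _ _ _).inter (hH _ _ _)).inter ((hH _ _ _).inter (hH _ _ _))).inter
      ((hH _ _ _).inter (hH _ _ _))
  have hRmem : ∀ y, y ∈ R ↔ |y i| < δ ∧ |y j - σ j * q| < δ ∧ |y i| < q - σ j * y j := by
    intro y
    simp only [R, H, mem_inter_iff, mem_ofPred_eq, abs_lt]
    constructor
    · rintro ⟨⟨⟨h1, h2⟩, h3, h4⟩, h5, h6⟩
      refine ⟨⟨?_, ?_⟩, ⟨?_, ?_⟩, ?_, ?_⟩ <;> linarith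
    · rintro ⟨⟨h1, h2⟩, ⟨h3, h4⟩, h5, h6⟩
      refine ⟨⟨⟨?_, ?_⟩, ?_, ?_⟩, ?_, ?_⟩ <;> linarith
  have hRK : ∀ x ∈ R, x ∉ frontier Ω := by
    intro x hx hxK
    obtain ⟨h1, h2, h3⟩ := (hRmem x).1 hx
    have h4 := hδK x hxK h1 h2
    have h5 : |x j - σ j * q| = |q - σ j * x j| := by
      have : q - σ j * x j = - (σ j * (x j - σ j * q)) := by rw [mul_sub, hσσ]; ring
      rw [this, abs_neg, abs_mul, habs, one_mul]
    rw [h5] at h4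
    linarith [le_abs_self (q - σ j * x j), abs_nonneg (x i)]
  -- a point of `R` in `Ω`
  have hex : ∃ x ∈ R, x ∈ Ω := by
    have hq' : ∀ᶠ t in 𝓝 M, q - √(t / b j) < δ := by
      have : ContinuousAt (fun t : ℝ => q - √(t / b j)) M := by fun_prop
      exact this.eventually_lt_const (by simpa [hq] using hδ)
    obtain ⟨ε, hε, hball⟩ := Metric.eventually_nhds_iff.1 hq'
    obtain ⟨t, h1, h2, h3, h4⟩ := good_level hΩ hb hσ hN hnull hM hR ε hε
    have h5 : q - √(t / b j) < δ := hball (by rw [Real.dist_eq, abs_lt]; constructor <;> linarith)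
    have h6 : √(t / b j) < q := Real.sqrt_lt_sqrt (by positivity) (by gcongr)
    have c1 : ContinuousAt (fun s : ℝ => q - √((t - b i * s ^ 2) / b j)) 0 := by fun_prop
    have c2 : ContinuousAt (fun s : ℝ => q - √((t - b i * s ^ 2) / b j) - s) 0 := by fun_prop
    have c3 : ContinuousAt (fun s : ℝ => t - b i * s ^ 2) 0 := by fun_prop
    have e1 := c1.eventually_lt_const (show _ < δ by simpa using h5)
    have e2 : ∀ᶠ s in 𝓝 (0 : ℝ), 0 < q - √((t - b i * s ^ 2) / b j) - s :=
      c2.eventually_const_lt (by simpa using h6)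
    have e3 : ∀ᶠ s in 𝓝 (0 : ℝ), 0 < t - b i * s ^ 2 :=
      c3.eventually_const_lt (by simpa using h3)
    have e4 : ∀ᶠ s in 𝓝 (0 : ℝ), s < δ := eventually_lt_nhds hδ
    have e5 : ∀ᶠ s in 𝓝[>] (0 : ℝ), 0 < s := self_mem_nhdsWithin
    obtain ⟨s, hs, h7, h8, h9, h10⟩ := (e5.and (nhdsWithin_le_nhds
      (e1.and (e2.and (e3.and e4))))).exists
    set w := √((t - b i * s ^ 2) / b j) with hw
    have hwpos : 0 < w := Real.sqrt_pos.2 (by positivity)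
    have hxi : pt i (σ i * s) (σ j * w) i = σ i * s := pt_i _ _ _
    have hxj : pt i (σ i * s) (σ j * w) j = σ j * w := pt_j hij _ _
    refine ⟨pt i (σ i * s) (σ j * w), (hRmem _).2 ?_, h4 _ ?_ ?_⟩
    · rw [hxi, hxj, ← mul_sub, abs_mul, abs_mul, habs, habs, one_mul, one_mul, hσσ,
        abs_of_pos hs, abs_of_neg (by linarith)]
      refine ⟨h10, ?_, ?_⟩ <;> linarith
    · refine (forall_ij hij).2 ⟨?_, ?_⟩
      · rw [hxi, hσσ]; exact hs
      · rw [hxj, hσσ]; exact hwpos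
    · rw [qf_pt hij, mul_pow, mul_pow, sgn_sq (hσ i), sgn_sq (hσ j), one_mul, one_mul, hw,
        Real.sq_sqrt (by positivity)]
      field_simp
      ring
  obtain ⟨x, hxR, hxΩ⟩ := hex
  intro ε hε
  have c1 : ContinuousAt (fun s : ℝ => b i * s ^ 2 + b j * (q - 2 * s) ^ 2) 0 := by fun_prop
  have e1 := c1.eventually_const_lt (show M - ε < _ by simp [hq2]; exact hε)
  have e2 : ∀ᶠ s in 𝓝 (0 : ℝ), s < min (q / 2) (δ / 2) := eventually_lt_nhds (by positivity)
  have e5 : ∀ᶠ s in 𝓝[>] (0 : ℝ), 0 < s := self_mem_nhdsWithin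
  obtain ⟨s, hs, h7, h8⟩ := (e5.and (nhdsWithin_le_nhds (e1.and e2))).exists
  obtain ⟨h8, h9⟩ := lt_min_iff.1 h8
  have hxi : pt i (-σ i * s) (σ j * (q - 2 * s)) i = -σ i * s := pt_i _ _ _
  have hxj : pt i (-σ i * s) (σ j * (q - 2 * s)) j = σ j * (q - 2 * s) := pt_j hij _ _
  refine ⟨pt i (-σ i * s) (σ j * (q - 2 * s)), ?_, ?_, ?_⟩
  · refine mem_of_preconnected hRconv.isPreconnected hRK hxR hxΩ ((hRmem _).2 ?_)
    rw [hxi, hxj, ← mul_sub, abs_mul, abs_mul, abs_neg, habs, habs, one_mul, one_mul, hσσ,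
        abs_of_pos hs, abs_of_neg (by linarith)]
    refine ⟨?_, ?_, ?_⟩ <;> linarith
  · refine (forall_ij hij).2 ⟨?_, ?_⟩
    · rw [hxi, hτi, neg_mul, neg_mul, mul_neg, neg_neg, hσσ]; exact hs
    · rw [hxj, hτj, hσσ]; linarith
  · rw [qf_pt hij, mul_pow, mul_pow, neg_sq, sgn_sq (hσ i), sgn_sq (hσ j), one_mul, one_mul]
    exact h7

lemma exists_reach {Ω : Set (Fin 2 → ℝ)} (hΩ : IsOpen Ω) {b : Fin 2 → ℝ} {M : ℝ}
    (hMc : ∀ ε > 0, ∃ x ∈ Ω, M - ε < qf b x) :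
    ∃ σ : Fin 2 → ℝ, (∀ k, σ k = 1 ∨ σ k = -1) ∧ Reach Ω b M σ := by
  let S : (Fin 2 → Bool) → Fin 2 → ℝ := fun β k => if β k then 1 else -1
  have hS : ∀ β k, S β k = 1 ∨ S β k = -1 := by
    intro β k
    by_cases h : β k <;> simp [S, h]
  by_contra! hcon
  have h1 : ∀ β, ∃ ε > 0, ∀ x ∈ Ω, Quad (S β) x → qf b x ≤ M - ε := by
    intro β
    have := hcon (S β) (hS β)
    unfold Reach at this
    push Not at this
    exact this
  choose ε hε hx using h1
  obtain ⟨β₀, hβ₀⟩ := Finite.exists_min ε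
  obtain ⟨x, hxΩ, hxM⟩ := hMc (ε β₀) (hε β₀)
  have hopen : IsOpen (Ω ∩ {x | M - ε β₀ < qf b x}) :=
    hΩ.inter (isOpen_lt continuous_const (continuous_qf b))
  have hcont : ContinuousAt (fun s : ℝ => fun k => x k + s) 0 := by fun_prop
  have e1 : ∀ᶠ s in 𝓝 (0 : ℝ), (fun k => x k + s) ∈ Ω ∩ {x | M - ε β₀ < qf b x} :=
    hcont.eventually_mem (hopen.mem_nhds (by simpa using ⟨hxΩ, hxM⟩))
  have e1' : ∀ᶠ s in 𝓝[>] (0 : ℝ), (fun k => x k + s) ∈ Ω ∩ {x | M - ε β₀ < qf b x} :=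
    nhdsWithin_le_nhds e1
  have e2 : ∀ k, ∀ᶠ s in 𝓝[>] (0 : ℝ), x k + s ≠ 0 := by
    intro k
    by_cases hk : x k = 0
    · filter_upwards [self_mem_nhdsWithin] with s hs
      rw [hk, zero_add]; exact ne_of_gt hs
    · have : ContinuousAt (fun s : ℝ => x k + s) 0 := by fun_prop
      exact nhdsWithin_le_nhds (this.eventually_ne (by simpa using hk))
  obtain ⟨s, ⟨h1, h2⟩, h3⟩ := (e1'.and (eventually_all.2 e2)).exists
  have h4 := hx (fun k => decide (0 < x k + s)) _ h1 (by
    intro k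
    by_cases hk : 0 < x k + s
    · simp [S, hk]
    · have := lt_of_le_of_ne (not_lt.1 hk) (h3 k)
      simp [S, hk, -neg_add_rev]; exact this)
  have h5 := hβ₀ (fun k => decide (0 < x k + s))
  have h6 : M - ε β₀ < qf b fun k => x k + s := h2
  linarith

theorem stmt_19 (Ω : Set (Fin 2 → ℝ)) (hΩ : IsOpen Ω) (hne : Ω.Nonempty)
    (hbdd : Bornology.IsBounded Ω) (hconn : IsConnected (frontier Ω))
    (a₁ a₂ : ℝ) (ha₁ : 0 < a₁) (ha₂ : 0 < a₂)
    (ν : (Fin 2 → ℝ) → (Fin 2 → ℝ))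
    (hunit : ∀ x ∈ frontier Ω, (ν x 0) ^ 2 + (ν x 1) ^ 2 = 1)
    (htang : ∀ x ∈ frontier Ω, ∀ v ∈ tangentConeAt ℝ (frontier Ω) x,
      ν x 0 * v 0 + ν x 1 * v 1 = 0)
    (hprop : ∀ x ∈ frontier Ω, x 0 * x 1 ≠ 0 →
      a₁ * ν x 0 / x 0 = a₂ * ν x 1 / x 1) :
    ∃ c : ℝ, 0 < c ∧ ∀ x ∈ frontier Ω, a₂ * (x 0) ^ 2 + a₁ * (x 1) ^ 2 = c := by
  set b : Fin 2 → ℝ := pt 0 a₂ a₁ with hbdef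
  have hb0 : b 0 = a₂ := rfl
  have hb1 : b 1 = a₁ := rfl
  have hb : ∀ k, 0 < b k := by
    intro k; fin_cases k
    · exact ha₂
    · exact ha₁
  have hν : ∀ x ∈ frontier Ω, ∃ n : Fin 2 → ℝ, n 0 ^ 2 + n 1 ^ 2 = 1 ∧ ∀ ε > 0, ∃ δ > 0,
      ∀ y ∈ frontier Ω, ‖y - x‖ < δ →
        |n 0 * (y 0 - x 0) + n 1 * (y 1 - x 1)| ≤ ε * ‖y - x‖ := fun x hx =>
    ⟨ν x, hunit x hx, fun ε hε => littleO_of_tangent _ x _ _ (htang x hx) ε hε⟩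
  set N : Set ℝ := qf b '' {x | x ∈ frontier Ω ∧ x 0 * x 1 ≠ 0} with hNdef
  have hNnull : volume N = 0 := by
    refine sard_null (frontier Ω) b hb fun x hx hx01 ε hε => ?_
    refine littleO_of_tangent _ x _ _ (fun v hv => ?_) ε hε
    have hx0 : x 0 ≠ 0 := left_ne_zero_of_mul hx01
    have hx1 : x 1 ≠ 0 := right_ne_zero_of_mul hx01
    have h1 := htang x hx v hv
    have h2 := hprop x hx hx01
    have h3 := hunit x hx
    rw [div_eq_div_iff hx0 hx1] at h2
    rw [hb0, hb1]
    -- `(a₂ x₀, a₁ x₁)` is a multiple of `ν`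
    have h4 : a₂ * x 0 = (a₂ * x 0 * ν x 0 + a₁ * x 1 * ν x 1) * ν x 0 := by
      linear_combination (-(a₂ * x 0)) * h3 - ν x 1 * h2
    have h5 : a₁ * x 1 = (a₂ * x 0 * ν x 0 + a₁ * x 1 * ν x 1) * ν x 1 := by
      linear_combination (-(a₁ * x 1)) * h3 + ν x 0 * h2
    linear_combination v 0 * h4 + v 1 * h5 + (a₂ * x 0 * ν x 0 + a₁ * x 1 * ν x 1) * h1
  have hN : ∀ x ∈ frontier Ω, x 0 * x 1 ≠ 0 → qf b x ∈ N := fun x hx h => ⟨x, ⟨hx, h⟩, rfl⟩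
  have hnull : ∀ a c : ℝ, a < c → ∃ t ∈ Ioo a c, t ∉ N := by
    intro a c hac
    by_contra! hcon
    have h1 : volume (Ioo a c) = 0 := measure_mono_null hcon hNnull
    rw [Real.volume_Ioo, ENNReal.ofReal_eq_zero] at h1
    linarith
  have hcomp : IsCompact (closure Ω) := hbdd.isCompact_closure
  obtain ⟨x₀, hx₀, hmax⟩ := hcomp.exists_isMaxOn hne.closure (continuous_qf b).continuousOn
  set M := qf b x₀ with hMdef
  have hMcl : ∀ x ∈ closure Ω, qf b x ≤ M := fun x hx => hmax hx
  have hM : ∀ x ∈ Ω, qf b x ≤ M := fun x hx => hMcl x (subset_closure hx)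
  have hMc : ∀ ε > 0, ∃ x ∈ Ω, M - ε < qf b x := by
    intro ε hε
    have hopen : IsOpen {x | M - ε < qf b x} := isOpen_lt continuous_const (continuous_qf b)
    obtain ⟨x, h1, h2⟩ := mem_closure_iff.1 hx₀ _ hopen (by simp [← hMdef, hε])
    exact ⟨x, h2, h1⟩
  obtain ⟨σ, hσ, hR⟩ := exists_reach hΩ hMc
  have hMpos : 0 < M := by
    obtain ⟨x, hx, hxQ, -⟩ := hR 1 one_pos
    exact (quad_pos hb hxQ).trans_le (hM x hx)
  have h01 : (0 : Fin 2) ≠ 1 := by decide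
  have hall : ∀ τ : Fin 2 → ℝ, (∀ k, τ k = 1 ∨ τ k = -1) → Reach Ω b M τ := by
    intro τ hτ
    have step : ∀ ρ : Fin 2 → ℝ, (∀ k, ρ k = 1 ∨ ρ k = -1) → Reach Ω b M ρ → ∀ i j : Fin 2,
        i ≠ j → ∀ π : Fin 2 → ℝ, (π i = 1 ∨ π i = -1) → π j = ρ j → Reach Ω b M π := by
      intro ρ hρ hRρ i j hij π hπ hπj
      by_cases h : π i = ρ i
      · have : π = ρ := by
          funext k
          exact (forall_ij hij (p := fun k => π k = ρ k)).2 ⟨h, hπj⟩ k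
        rw [this]; exact hRρ
      · refine flip_reach hΩ hb hρ hN hnull hMpos hM hRρ hν hij ?_ hπj
        rcases hπ with h1 | h1 <;> rcases hρ i with h2 | h2 <;> rw [h1, h2] at h ⊢ <;> simp at h ⊢
    have hmid : Reach Ω b M (pt 0 (τ 0) (σ 1)) :=
      step σ hσ hR 0 1 h01 _ (by rw [pt_i]; exact hτ 0) (pt_j h01 _ _)
    refine step _ ?_ hmid 1 0 h01.symm τ (hτ 1) (pt_i _ _ _).symm
    refine (forall_ij h01).2 ⟨?_, ?_⟩
    · rw [pt_i]; exact hτ 0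
    · rw [pt_j h01]; exact hσ 1
  -- boundary points on the axes are isolated near the top level
  have haxis : ∀ i j : Fin 2, i ≠ j → ∀ s : ℝ, (s = 1 ∨ s = -1) → ∃ η > 0, ∀ y ∈ frontier Ω,
      y i = 0 → 0 ≤ s * y j → M - η < qf b y → qf b y = M := by
    intro i j hij s hs
    obtain ⟨δ, hδ, hδK⟩ := endpoint hΩ hb (σ := fun _ => s) (fun _ => hs) hN hnull hMpos hM
      (hall _ fun _ => hs) hν hij
    have hbj := hb j
    set q := √(M / b j) with hq
    have hqpos : 0 < q := Real.sqrt_pos.2 (by positivity)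
    have hq2 : b j * q ^ 2 = M := by rw [hq, Real.sq_sqrt (by positivity)]; field_simp
    refine ⟨δ * (b j * q), by positivity, fun y hy hyi hyj hyM => ?_⟩
    have hyle := hMcl y (frontier_subset_closure hy)
    have hqfy : qf b y = b j * (s * y j) ^ 2 := by
      rw [qf_ij hij, hyi, mul_pow, sgn_sq hs]; ring
    set u := s * y j with hu
    have huq : u ≤ q := by
      rw [hqfy, ← hq2] at hyle
      exact abs_le_of_sq_le_sq' (le_of_mul_le_mul_left hyle hbj) hqpos.le |>.2
    have hqu : q - u < δ := by
      rw [hqfy, ← hq2] at hyM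
      have h1 : b j * (q - u) * (q + u) < δ * (b j * q) := by nlinarith
      have h2 : b j * (q - u) * q ≤ b j * (q - u) * (q + u) := by
        apply mul_le_mul_of_nonneg_left _ (mul_nonneg hbj.le (by linarith))
        linarith
      have h3 : (q - u) * (b j * q) < δ * (b j * q) := by linarith
      exact lt_of_mul_lt_mul_right h3 (by positivity)
    have habs : |y j - s * q| = q - u := by
      have h1 : y j - s * q = s * (u - q) := by
        rw [hu, mul_sub, ← mul_assoc, ← sq, sgn_sq hs, one_mul]
      have h2 : |s| = 1 := by rcases hs with h | h <;> rw [h] <;> simp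
      rw [h1, abs_mul, h2, one_mul, abs_sub_comm, abs_of_nonneg (by linarith)]
    have h4 := hδK y hy (by rw [hyi, abs_zero]; exact hδ) (by rw [habs]; exact hqu)
    rw [habs, hyi, abs_zero, zero_div] at h4
    have : u = q := le_antisymm huq (by linarith)
    rw [hqfy, this, hq2]
  obtain ⟨η₁, hη₁, H₁⟩ := haxis 0 1 h01 1 (Or.inl rfl)
  obtain ⟨η₂, hη₂, H₂⟩ := haxis 0 1 h01 (-1) (Or.inr rfl)
  obtain ⟨η₃, hη₃, H₃⟩ := haxis 1 0 h01.symm 1 (Or.inl rfl)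
  obtain ⟨η₄, hη₄, H₄⟩ := haxis 1 0 h01.symm (-1) (Or.inr rfl)
  set η := min (min η₁ η₂) (min η₃ η₄) with hη
  have hηpos : 0 < η := lt_min (lt_min hη₁ hη₂) (lt_min hη₃ hη₄)
  have hη1 : η ≤ η₁ := (min_le_left _ _).trans (min_le_left _ _)
  have hη2 : η ≤ η₂ := (min_le_left _ _).trans (min_le_right _ _)
  have hη3 : η ≤ η₃ := (min_le_right _ _).trans (min_le_left _ _)
  have hη4 : η ≤ η₄ := (min_le_right _ _).trans (min_le_right _ _)
  have hax : ∀ y ∈ frontier Ω, y 0 * y 1 = 0 → M - η < qf b y → qf b y = M := by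
    intro y hy h0 hyM
    rcases mul_eq_zero.1 h0 with h | h
    · rcases le_total 0 (y 1) with h' | h'
      · exact H₁ y hy h (by linarith) (by linarith)
      · exact H₂ y hy h (by linarith) (by linarith)
    · rcases le_total 0 (y 0) with h' | h'
      · exact H₃ y hy h (by linarith) (by linarith)
      · exact H₄ y hy h (by linarith) (by linarith)
  have hx₀K : x₀ ∈ frontier Ω := by
    rw [hΩ.frontier_eq]
    refine ⟨hx₀, fun hx₀Ω => ?_⟩
    have hcont : ContinuousAt (fun r : ℝ => r • x₀) 1 := by fun_prop
    have hev : ∀ᶠ r in 𝓝 (1 : ℝ), r • x₀ ∈ Ω :=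
      hcont.eventually_mem (hΩ.mem_nhds (by simpa using hx₀Ω))
    obtain ⟨δ, hδ, hball⟩ := Metric.eventually_nhds_iff.1 hev
    have := hM _ (hball (y := 1 + δ / 2) (by
      rw [Real.dist_eq, abs_lt]; constructor <;> linarith))
    rw [qf_smul, ← hMdef] at this
    nlinarith [mul_pos hδ hMpos, mul_pos (mul_pos hδ hδ) hMpos]
  refine ⟨M, hMpos, fun x hx => ?_⟩
  show qf b x = M
  by_contra hxM
  have hlt : qf b x < M := lt_of_le_of_ne (hMcl x (frontier_subset_closure hx)) hxM
  obtain ⟨t, ⟨ht1, ht2⟩, htN⟩ := hnull (max (qf b x) (M - η)) M (max_lt hlt (by linarith))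
  obtain ⟨ht1, ht3⟩ := max_lt_iff.1 ht1
  obtain ⟨y, hy, hyt⟩ := hconn.isPreconnected.intermediate_value hx hx₀K
    (continuous_qf b).continuousOn ⟨ht1.le, ht2.le⟩
  by_cases h0 : y 0 * y 1 = 0
  · have := hax y hy h0 (by rw [hyt]; exact ht3)
    linarith
  · exact htN (hyt ▸ hN y hy h0)
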